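/- Let d, κ, L₁, L₂ ∈ (0,∞), β₊, β₋ ∈ (0,∞), θ̄ ∈ ℝ, Γ = (L₁𝕋)×(L₂𝕋), Ω = Γ×(−d,0), Σ± as usual, and let θ_eq(x) = (κβ₊θ̄ + β₊β₋θ̄(x₃+d))/(κ(β₊+β₋)+β₊β₋d). Suppose u : [0,∞)×Ω̄ → ℝ³ is smooth with div u(t,·) = 0 in Ω and u₃ = 0 on Σ₊ and Σ₋, that g : [0,∞) → [0,∞) is continuous with ‖u(t,·)‖_{L²(Ω)} ≤ g(t) for all t, and that θ : [0,∞)×Ω̄ → ℝ is a smooth bounded solution of ∂ₜθ + u·∇θ = κΔθ in Ω, κ∂₃θ = β₊(θ̄−θ) on Σ₊, κ∂₃θ = β₋θ on Σ₋. Set μ = min{κπ²/(4d²), β₊β₋/κ}. Then for all t ≥ 0, ‖θ(t,·) − θ_eq‖_{L²(Ω)} ≤ e^{−μt}‖θ(0,·) − θ_eq‖_{L²(Ω)} + |∂₃θ_eq| ∫_0^t e^{−μ(t−s)} g(s) ds, where ∂₃θ_eq = β₊β₋θ̄/(κ(β₊+β₋)+β₊β₋d). -/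

import Mathlib

open MeasureTheory Real Set

noncomputable section

/-- Partial derivative of `f : ℝ³ → ℝ` in the `i`-th coordinate direction. -/
def pd (i : Fin 3) (f : (Fin 3 → ℝ) → ℝ) (x : Fin 3 → ℝ) : ℝ :=
  fderiv ℝ f x (Pi.single i 1)

/-- Fundamental domain `(0,L₁)×(0,L₂)×(−d,0)` of the periodic slab `Ω = Γ×(−d,0)`. -/
def slab (L₁ L₂ d : ℝ) : Set (Fin 3 → ℝ) :=
  Set.univ.pi ![Ioo 0 L₁, Ioo 0 L₂, Ioo (-d) 0]

/-- A solution of the Riccati equation `w' = -k² - w²` on `[-d, 0]` with Robin-compatible end values. -/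
theorem exists_robin_riccati_weight {d k hp hm : ℝ} (hd : 0 < d) (hk : 0 < k) (hhp : 0 < hp)
    (hkd : k * d ≤ π / 2) (hkh : k ^ 2 ≤ hp * hm) :
    ∃ w : ℝ → ℝ, (∀ z ∈ Icc (-d) 0, HasDerivAt w (-k ^ 2 - w z ^ 2) z) ∧
      -hp ≤ w 0 ∧ w (-d) ≤ hm := by
  have hA : 0 < arctan (hp / k) := by
    rw [← arctan_zero]; exact arctan_strictMono (by positivity)
  have hA' := arctan_lt_pi_div_two (hp / k)
  refine ⟨fun z => -k * tan (k * z + arctan (hp / k)), fun z hz => ?_, ?_, ?_⟩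
  · have h1 : 0 ≤ k * (z + d) := mul_nonneg hk.le (by linarith [hz.1])
    have h2 : k * z ≤ 0 := mul_nonpos_of_nonneg_of_nonpos hk.le hz.2
    have hc : cos (k * z + arctan (hp / k)) ≠ 0 :=
      (cos_pos_of_mem_Ioo ⟨by linarith, by linarith⟩).ne'
    have hlin : HasDerivAt (fun z => k * z + arctan (hp / k)) k z := by
      simpa using ((hasDerivAt_id z).const_mul k).add_const (arctan (hp / k))
    refine (((hasDerivAt_tan hc).comp z hlin).const_mul (-k)).congr_deriv ?_
    simp only [tan_eq_sin_div_cos]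
    field_simp
    rw [← sin_sq_add_cos_sq (k * z + arctan (hp / k))]
    ring
  · simp only [mul_zero, zero_add, tan_arctan]
    field_simp
    exact le_rfl
  · have h1 : k * d - arctan (hp / k) ≤ arctan (hp / k)⁻¹ := by
      rw [arctan_inv_of_pos (by positivity)]; linarith
    have h2 : tan (k * d - arctan (hp / k)) ≤ k / hp := by
      have h3 := arctan_lt_pi_div_two (hp / k)⁻¹
      have hle : tan (k * d - arctan (hp / k)) ≤ tan (arctan (hp / k)⁻¹) :=
        strictMonoOn_tan.monotoneOn ⟨by nlinarith [mul_pos hk hd], by linarith⟩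
          ⟨neg_pi_div_two_lt_arctan _, h3⟩ h1
      rwa [tan_arctan, inv_div] at hle
    have h4 : k * -d + arctan (hp / k) = -(k * d - arctan (hp / k)) := by ring
    simp only [h4, tan_neg, neg_mul_neg]
    calc k * tan (k * d - arctan (hp / k)) ≤ k * (k / hp) := by gcongr
      _ ≤ hm := by rw [← mul_div_assoc, div_le_iff₀ hhp]; nlinarith

theorem slab_eq_pi_Ioo (L₁ L₂ d : ℝ) :
    slab L₁ L₂ d = univ.pi fun i => Ioo ((![0, 0, -d] : Fin 3 → ℝ) i) (![L₁, L₂, 0] i) := by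
  unfold slab
  congr 1
  ext i : 1
  fin_cases i <;> rfl

theorem slab_ae_eq_Icc (L₁ L₂ d : ℝ) :
    slab L₁ L₂ d =ᵐ[volume] Icc (![0, 0, -d] : Fin 3 → ℝ) ![L₁, L₂, 0] := by
  rw [slab_eq_pi_Ioo]
  exact Measure.univ_pi_Ioo_ae_eq_Icc

theorem slab_subset_Icc (L₁ L₂ d : ℝ) :
    slab L₁ L₂ d ⊆ Icc (![0, 0, -d] : Fin 3 → ℝ) ![L₁, L₂, 0] := by
  rw [slab_eq_pi_Ioo, ← pi_univ_Icc]
  exact pi_mono fun i _ => Ioo_subset_Icc_self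

theorem measurableSet_slab (L₁ L₂ d : ℝ) : MeasurableSet (slab L₁ L₂ d) := by
  rw [slab_eq_pi_Ioo]
  exact MeasurableSet.univ_pi fun _ => measurableSet_Ioo

theorem ContinuousOn.integrableOn_slab {L₁ L₂ d : ℝ} {f : (Fin 3 → ℝ) → ℝ}
    (hf : ContinuousOn f (Icc ![0, 0, -d] ![L₁, L₂, 0])) : IntegrableOn f (slab L₁ L₂ d) :=
  (hf.integrableOn_compact isCompact_Icc).mono_set (slab_subset_Icc L₁ L₂ d)

theorem Continuous.integrableOn_slab {L₁ L₂ d : ℝ} {f : (Fin 3 → ℝ) → ℝ} (hf : Continuous f) :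
    IntegrableOn f (slab L₁ L₂ d) :=
  hf.continuousOn.integrableOn_slab

theorem ContDiff.pd {m n : WithTop ℕ∞} {f : (Fin 3 → ℝ) → ℝ} (hf : ContDiff ℝ n f)
    (hmn : m + 1 ≤ n) (i : Fin 3) : ContDiff ℝ m (pd i f) :=
  (hf.fderiv_right hmn).clm_apply contDiff_const

theorem pd_add_period {f : (Fin 3 → ℝ) → ℝ} {e : Fin 3 → ℝ} (hf : ∀ x, f (x + e) = f x)
    (i : Fin 3) (x : Fin 3 → ℝ) : pd i f (x + e) = pd i f x := by
  have h := fderiv_comp_add_right (𝕜 := ℝ) (f := f) (x := x) e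
  simp only [hf] at h
  simp only [pd, ← h]

/-- Coercive energy inequality for the advection-diffusion operator with Robin conditions: the
divergence theorem applied to `κ f ∇f - f² v / 2 - κ w f² e₃`, with `w` a Riccati weight. -/
theorem robin_energy_inequality {d κ L₁ L₂ βp βm k : ℝ}
    (hd : 0 < d) (hκ : 0 < κ) (hL₁ : 0 < L₁) (hL₂ : 0 < L₂)
    {w : ℝ → ℝ} (hw : ∀ z ∈ Icc (-d) 0, HasDerivAt w (-k ^ 2 - w z ^ 2) z)
    (hw_top : -βp ≤ κ * w 0) (hw_bot : κ * w (-d) ≤ βm)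
    {f : (Fin 3 → ℝ) → ℝ} {v : (Fin 3 → ℝ) → Fin 3 → ℝ}
    (hf : ContDiff ℝ 2 f) (hv : ContDiff ℝ 1 v)
    (hv_per1 : ∀ x, v (x + Pi.single 0 L₁) = v x) (hv_per2 : ∀ x, v (x + Pi.single 1 L₂) = v x)
    (hf_per1 : ∀ x, f (x + Pi.single 0 L₁) = f x) (hf_per2 : ∀ x, f (x + Pi.single 1 L₂) = f x)
    (hdiv : ∀ x ∈ slab L₁ L₂ d, ∑ i, pd i (fun y => v y i) x = 0)
    (hv_top : ∀ p : ℝ × ℝ, v ![p.1, p.2, 0] 2 = 0) (hv_bot : ∀ p : ℝ × ℝ, v ![p.1, p.2, -d] 2 = 0)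
    (hf_top : ∀ p : ℝ × ℝ, κ * pd 2 f ![p.1, p.2, 0] = -(βp * f ![p.1, p.2, 0]))
    (hf_bot : ∀ p : ℝ × ℝ, κ * pd 2 f ![p.1, p.2, -d] = βm * f ![p.1, p.2, -d]) :
    ∫ x in slab L₁ L₂ d, f x * (κ * ∑ i, pd i (pd i f) x - ∑ i, v x i * pd i f x) ≤
      -(κ * k ^ 2) * ∫ x in slab L₁ L₂ d, f x ^ 2 := by
  set a : Fin 3 → ℝ := ![0, 0, -d] with ha
  set b : Fin 3 → ℝ := ![L₁, L₂, 0] with hb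
  have hle : a ≤ b := fun i => by fin_cases i <;> simp [ha, hb, hL₁.le, hL₂.le, hd.le]
  let c : Fin 3 → ℝ := ![0, 0, 1]
  have hmem : ∀ x ∈ Icc a b, x 2 ∈ Icc (-d) 0 := fun x hx => ⟨hx.1 2, hx.2 2⟩
  have hwc : ContinuousOn (fun x : Fin 3 → ℝ => w (x 2)) (Icc a b) :=
    ContinuousOn.comp (t := Icc (-d) 0) (fun z hz => (hw z hz).continuousAt.continuousWithinAt)
      (continuous_apply 2).continuousOn hmem
  have hvi : ∀ i, ContDiff ℝ 1 fun y => v y i := fun i => contDiff_pi.1 hv i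
  have hfc := hf.continuous
  have hpf : ∀ i, ContDiff ℝ 1 (pd i f) := fun i => hf.pd (by norm_num) i
  have hpfc := fun i => (hpf i).continuous
  have hppfc : ∀ i, Continuous (pd i (pd i f)) := fun i => ((hpf i).pd (m := 0) (by simp) i).continuous
  have hvc := fun i => (hvi i).continuous
  have hpvc : ∀ i, Continuous (pd i fun y => v y i) :=
    fun i => ((hvi i).pd (m := 0) (by simp) i).continuous
  let F : Fin 3 → (Fin 3 → ℝ) → ℝ := fun i x =>
    κ * (f x * pd i f x) - v x i * (f x * f x) / 2 - κ * c i * (w (x 2) * (f x * f x))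
  let F' : Fin 3 → (Fin 3 → ℝ) → (Fin 3 → ℝ) →L[ℝ] ℝ := fun i x =>
    κ • (f x • fderiv ℝ (pd i f) x + pd i f x • fderiv ℝ f x)
      - (1 / 2 : ℝ) • (v x i • (f x • fderiv ℝ f x + f x • fderiv ℝ f x)
        + (f x * f x) • fderiv ℝ (fun y => v y i) x)
      - (κ * c i) • (w (x 2) • (f x • fderiv ℝ f x + f x • fderiv ℝ f x)
        + (f x * f x) • ((-k ^ 2 - w (x 2) ^ 2) • ContinuousLinearMap.proj 2))
  let G : (Fin 3 → ℝ) → ℝ := fun x =>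
    f x * (κ * ∑ i, pd i (pd i f) x - ∑ i, v x i * pd i f x) + κ * k ^ 2 * f x ^ 2
  let Q : (Fin 3 → ℝ) → ℝ := fun x =>
    κ * ((pd 0 f x) ^ 2 + (pd 1 f x) ^ 2 + (pd 2 f x - w (x 2) * f x) ^ 2)
      - (∑ i, pd i (fun y => v y i) x) * (f x * f x) / 2
  have hF'_sum : ∀ x, ∑ i, F' i x (Pi.single i 1) = G x + Q x := by
    intro x
    simp only [F', G, Q, c, Fin.sum_univ_three, pd]
    simp
    ring
  have hFc : ∀ i, ContinuousOn (F i) (Icc a b) := fun i => by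
    have h1 : Continuous fun x => κ * (f x * pd i f x) - v x i * (f x * f x) / 2 := by fun_prop
    exact h1.continuousOn.sub (continuousOn_const.mul (hwc.mul (hfc.mul hfc).continuousOn))
  have hGc : Continuous G := by fun_prop
  have hGQc : ContinuousOn (fun x => G x + Q x) (Icc a b) := by
    have h1 : Continuous fun x => pd 0 f x ^ 2 + pd 1 f x ^ 2 := by fun_prop
    have h2 : Continuous fun x => (∑ i, pd i (fun y => v y i) x) * (f x * f x) / 2 := by fun_prop
    exact hGc.continuousOn.add ((continuousOn_const.mul (h1.continuousOn.add
      (((hpfc 2).continuousOn.sub (hwc.mul hfc.continuousOn)).pow 2))).sub h2.continuousOn)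
  have hFd : ∀ x ∈ (univ.pi fun i => Ioo (a i) (b i)) \ ∅, ∀ i, HasFDerivAt (F i) (F' i x) x := by
    rintro x ⟨hx, -⟩ i
    have hx2 : x 2 ∈ Icc (-d) 0 := Ioo_subset_Icc_self (hx 2 (mem_univ _))
    have df : HasFDerivAt f (fderiv ℝ f x) x := (hf.differentiable (by simp) x).hasFDerivAt
    have dp : HasFDerivAt (pd i f) (fderiv ℝ (pd i f) x) x :=
      ((hpf i).differentiable (by simp) x).hasFDerivAt
    have dv : HasFDerivAt (fun y => v y i) (fderiv ℝ (fun y => v y i) x) x :=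
      ((hvi i).differentiable (by simp) x).hasFDerivAt
    have dw : HasFDerivAt (fun y : Fin 3 → ℝ => w (y 2))
        ((-k ^ 2 - w (x 2) ^ 2) • ContinuousLinearMap.proj 2 : (Fin 3 → ℝ) →L[ℝ] ℝ) x :=
      (hw (x 2) hx2).comp_hasFDerivAt x (hasFDerivAt_apply 2 x)
    have key := (((df.mul dp).const_mul κ).sub ((dv.mul (df.mul df)).const_mul (1 / 2))).sub
      ((dw.mul (df.mul df)).const_mul (κ * c i))
    refine key.congr_of_eventuallyEq (Filter.Eventually.of_forall fun y => ?_)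
    simp only [F, Pi.mul_apply, Pi.sub_apply]
    ring
  have hdivthm := integral_divergence_of_hasFDerivAt_off_countable' a b hle F F' ∅ countable_empty
    hFc hFd (by simpa only [hF'_sum] using hGQc.integrableOn_compact isCompact_Icc)
  simp only [hF'_sum] at hdivthm
  have hflux : ∫ x in Icc a b, (G x + Q x) ≤ 0 := by
    have e1 : ∀ y : Fin 2 → ℝ, (0 : Fin 3).insertNth (b 0) y
        = ((0 : Fin 3).insertNth (a 0) y : Fin 3 → ℝ) + Pi.single 0 L₁ := fun y => by
      ext j; refine Fin.cases ?_ (fun j => ?_) j <;> simp [ha, hb]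
    have e2 : ∀ y : Fin 2 → ℝ, (1 : Fin 3).insertNth (b 1) y
        = ((1 : Fin 3).insertNth (a 1) y : Fin 3 → ℝ) + Pi.single 1 L₂ := fun y => by
      ext j; fin_cases j <;> simp [ha, hb, Fin.insertNth, Fin.succAboveCases]
    have e3 : ∀ y : Fin 2 → ℝ, ((2 : Fin 3).insertNth (b 2) y : Fin 3 → ℝ) = ![y 0, y 1, 0] :=
      fun y => by ext j; fin_cases j <;> rfl
    have e4 : ∀ y : Fin 2 → ℝ, ((2 : Fin 3).insertNth (a 2) y : Fin 3 → ℝ) = ![y 0, y 1, -d] :=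
      fun y => by ext j; fin_cases j <;> rfl
    have p1 : ∀ x, F 0 (x + Pi.single 0 L₁) = F 0 x := fun x => by
      simp only [F, hf_per1, pd_add_period hf_per1, hv_per1, c]
      simp
    have p2 : ∀ x, F 1 (x + Pi.single 1 L₂) = F 1 x := fun x => by
      simp only [F, hf_per2, pd_add_period hf_per2, hv_per2, c]
      simp
    have p3 : ∀ y : Fin 2 → ℝ, F 2 ![y 0, y 1, 0] ≤ 0 := fun y => by
      have h1 := hf_top (y 0, y 1)
      have h2 := hv_top (y 0, y 1)
      simp only at h1 h2
      have h3 : F 2 ![y 0, y 1, 0] = -((βp + κ * w 0) * f ![y 0, y 1, 0] ^ 2) := by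
        simp only [F, h2, c, Matrix.cons_val]
        linear_combination f ![y 0, y 1, 0] * h1
      rw [h3, neg_nonpos]
      exact mul_nonneg (by linarith) (sq_nonneg _)
    have p4 : ∀ y : Fin 2 → ℝ, 0 ≤ F 2 ![y 0, y 1, -d] := fun y => by
      have h1 := hf_bot (y 0, y 1)
      have h2 := hv_bot (y 0, y 1)
      simp only at h1 h2
      have h3 : F 2 ![y 0, y 1, -d] = (βm - κ * w (-d)) * f ![y 0, y 1, -d] ^ 2 := by
        simp only [F, h2, c, Matrix.cons_val]
        linear_combination f ![y 0, y 1, -d] * h1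
      rw [h3]
      exact mul_nonneg (by linarith) (sq_nonneg _)
    rw [hdivthm, Fin.sum_univ_three]
    simp only [e1, e2, e3, e4, p1, p2, sub_self, zero_add]
    exact sub_nonpos.2 ((integral_nonpos p3).trans (integral_nonneg p4))
  have hmono : ∫ x in slab L₁ L₂ d, G x ≤ ∫ x in slab L₁ L₂ d, (G x + Q x) := by
    refine setIntegral_mono_on hGc.integrableOn_slab hGQc.integrableOn_slab
      (measurableSet_slab _ _ _) fun x hx => ?_
    have : 0 ≤ Q x := by
      simp only [Q, hdiv x hx]
      have := hκ.le
      simp only [zero_mul, zero_div, sub_zero]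
      positivity
    linarith
  have hG_nonpos := (hmono.trans_eq (setIntegral_congr_set (slab_ae_eq_Icc L₁ L₂ d))).trans hflux
  have hG_split : ∫ x in slab L₁ L₂ d, G x =
      (∫ x in slab L₁ L₂ d, f x * (κ * ∑ i, pd i (pd i f) x - ∑ i, v x i * pd i f x))
        + κ * k ^ 2 * ∫ x in slab L₁ L₂ d, f x ^ 2 := by
    rw [← integral_const_mul]
    exact integral_add (Continuous.integrableOn_slab (by fun_prop))
      (Continuous.integrableOn_slab (by fun_prop))
  linarith

/-- Cauchy–Schwarz inequality on the slab. -/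
theorem abs_setIntegral_slab_mul_le {L₁ L₂ d : ℝ} {f h : (Fin 3 → ℝ) → ℝ} (hf : Continuous f)
    (hh : Continuous h) :
    |∫ x in slab L₁ L₂ d, f x * h x| ≤
      √(∫ x in slab L₁ L₂ d, f x ^ 2) * √(∫ x in slab L₁ L₂ d, h x ^ 2) := by
  have mem : ∀ {q : (Fin 3 → ℝ) → ℝ}, Continuous q →
      MemLp q (ENNReal.ofReal 2) (volume.restrict (slab L₁ L₂ d)) := fun {q} hq => by
    rw [ENNReal.ofReal_ofNat, memLp_two_iff_integrable_sq hq.aestronglyMeasurable]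
    exact (hq.pow 2).integrableOn_slab
  have key := integral_mul_norm_le_Lp_mul_Lq Real.HolderConjugate.two_two (mem hf) (mem hh)
  simp only [Real.rpow_two, norm_eq_abs, sq_abs, ← sqrt_eq_rpow] at key
  refine (abs_integral_le_integral_abs).trans ?_
  simpa only [abs_mul] using key

/-- Differentiation under the integral over the slab. -/
theorem hasDerivAt_setIntegral_slab {L₁ L₂ d : ℝ} {F F' : ℝ → (Fin 3 → ℝ) → ℝ}
    (hF : Continuous fun q : ℝ × (Fin 3 → ℝ) => F q.1 q.2)
    (hF' : Continuous fun q : ℝ × (Fin 3 → ℝ) => F' q.1 q.2)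
    (hderiv : ∀ t x, HasDerivAt (F · x) (F' t x) t) (t : ℝ) :
    HasDerivAt (fun t => ∫ x in slab L₁ L₂ d, F t x) (∫ x in slab L₁ L₂ d, F' t x) t := by
  have sec : ∀ {G : ℝ → (Fin 3 → ℝ) → ℝ}, (Continuous fun q : ℝ × (Fin 3 → ℝ) => G q.1 q.2) →
      ∀ s, Continuous (G s) := fun hG s => hG.comp (Continuous.prodMk_right s)
  obtain ⟨C, hC⟩ := ((isCompact_Icc (a := t - 1) (b := t + 1)).prod
    (isCompact_Icc (a := (![0, 0, -d] : Fin 3 → ℝ)) (b := ![L₁, L₂, 0]))).exists_bound_of_continuousOn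
      hF'.continuousOn
  refine (hasDerivAt_integral_of_dominated_loc_of_deriv_le (bound := fun _ => C)
    (Icc_mem_nhds (sub_one_lt t) (lt_add_one t))
    (Filter.Eventually.of_forall fun s => (sec hF s).aestronglyMeasurable)
    (sec hF t).integrableOn_slab (sec hF' t).aestronglyMeasurable ?_
    continuous_const.integrableOn_slab
    (Filter.Eventually.of_forall fun x s _ => hderiv s x)).2
  filter_upwards [ae_restrict_mem (measurableSet_slab L₁ L₂ d)] with x hx s hs
  exact hC (s, x) ⟨hs, slab_subset_Icc _ _ _ hx⟩

/-- Grönwall estimate for `√E` from the differential inequality `E' ≤ -2μE + 2cg√E`. -/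
theorem sqrt_le_exp_mul_sqrt_add_integral {E E' g : ℝ → ℝ} {μ c : ℝ} (hμ : 0 ≤ μ) (hc : 0 ≤ c)
    (hE : ∀ t, HasDerivAt E (E' t) t) (hE_nonneg : ∀ t, 0 ≤ E t)
    (hg : Continuous g) (hg_nonneg : ∀ t, 0 ≤ g t)
    (hE' : ∀ t, 0 ≤ t → E' t ≤ -(2 * μ * E t) + 2 * c * g t * √(E t)) {t : ℝ} (ht : 0 ≤ t) :
    √(E t) ≤ exp (-(μ * t)) * √(E 0) + c * ∫ s in (0 : ℝ)..t, exp (-(μ * (t - s))) * g s := by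
  refine le_of_forall_pos_le_add fun δ hδ => ?_
  let y : ℝ → ℝ := fun s => √(E s + δ ^ 2)
  have hpos : ∀ s, 0 < E s + δ ^ 2 := fun s => by have := hE_nonneg s; positivity
  have hy_pos : ∀ s, 0 < y s := fun s => sqrt_pos.2 (hpos s)
  have hy_sq : ∀ s, y s ^ 2 = E s + δ ^ 2 := fun s => sq_sqrt (hpos s).le
  have hδy : ∀ s, δ ≤ y s := fun s => le_sqrt_of_sq_le (by linarith [hE_nonneg s])
  have hEy : ∀ s, √(E s) ≤ y s := fun s => sqrt_le_sqrt (by nlinarith)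
  have hy : ∀ s, HasDerivAt y (E' s / (2 * y s)) s := fun s =>
    ((hE s).add_const (δ ^ 2)).sqrt (hpos s).ne'
  have hgc : Continuous fun s => exp (μ * s) * (c * g s) := by fun_prop
  let Z : ℝ → ℝ := fun s => exp (μ * s) * (y s - δ) - ∫ r in (0 : ℝ)..s, exp (μ * r) * (c * g r)
  have hexp : ∀ s, HasDerivAt (fun s => exp (μ * s)) (exp (μ * s) * μ) s := fun s => by
    simpa using ((hasDerivAt_id s).const_mul μ).exp
  have hZ : ∀ s, HasDerivAt Z (exp (μ * s) * μ * (y s - δ) + exp (μ * s) * (E' s / (2 * y s))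
      - exp (μ * s) * (c * g s)) s := fun s =>
    ((hexp s).mul ((hy s).sub_const δ)).sub (hgc.integral_hasStrictDerivAt 0 s).hasDerivAt
  have hZ_anti : AntitoneOn Z (Ici 0) := by
    refine antitoneOn_of_deriv_nonpos (convex_Ici 0)
      (fun s _ => (hZ s).continuousAt.continuousWithinAt)
      (fun s _ => (hZ s).differentiableAt.differentiableWithinAt) fun s hs => ?_
    rw [interior_Ici] at hs
    rw [(hZ s).deriv]
    have h1 : E' s / (2 * y s) ≤ -(μ * (y s - δ)) + c * g s := by
      rw [div_le_iff₀ (by linarith [hy_pos s])]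
      have h2 := hE' s hs.le
      have h3 : c * g s * √(E s) ≤ c * g s * y s :=
        mul_le_mul_of_nonneg_left (hEy s) (mul_nonneg hc (hg_nonneg s))
      have h4 : μ * (δ * δ) ≤ μ * (δ * y s) := by have := hδy s; gcongr
      have h5 : μ * E s = μ * (y s ^ 2 - δ ^ 2) := by rw [hy_sq]; ring
      linarith
    nlinarith [mul_le_mul_of_nonneg_left h1 (exp_pos (μ * s)).le]
  have hZt : Z t ≤ Z 0 := hZ_anti self_mem_Ici ht ht
  have hy0 : y 0 - δ ≤ √(E 0) := by
    rw [sub_le_iff_le_add]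
    refine sqrt_le_iff.2 ⟨by positivity, ?_⟩
    nlinarith [sq_sqrt (hE_nonneg 0), mul_nonneg (sqrt_nonneg (E 0)) hδ.le]
  have hint : exp (-(μ * t)) * ∫ r in (0 : ℝ)..t, exp (μ * r) * (c * g r)
      = c * ∫ s in (0 : ℝ)..t, exp (-(μ * (t - s))) * g s := by
    rw [← intervalIntegral.integral_const_mul, ← intervalIntegral.integral_const_mul]
    refine intervalIntegral.integral_congr fun s _ => ?_
    have : exp (-(μ * (t - s))) = exp (-(μ * t)) * exp (μ * s) := by rw [← exp_add]; ring_nf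
    simp only [this]
    ring
  simp only [Z, mul_zero, exp_zero, one_mul, intervalIntegral.integral_same, sub_zero] at hZt
  have h1 := mul_le_mul_of_nonneg_left (hZt.trans hy0) (exp_pos (-(μ * t))).le
  have h2 : exp (-(μ * t)) * exp (μ * t) = 1 := by rw [← exp_add]; simp
  rw [mul_sub, ← mul_assoc, h2, one_mul, hint] at h1
  linarith [hEy t]

/-- **Equilibration of the passive scalar on a rigid periodic slab with Robin boundary
conditions.**  If `θ` solves `∂ₜθ + u·∇θ = κΔθ` with `κ∂₃θ = β₊(θ̄−θ)` on `Σ₊`,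
`κ∂₃θ = β₋θ` on `Σ₋`, `u` divergence-free and tangent to the boundary with
`‖u(t)‖_{L²(Ω)} ≤ g(t)`, then with `μ = min{κπ²/(4d²), β₊β₋/κ}` and
`θ_eq` the Robin equilibrium, for all `t ≥ 0`,
`‖θ(t)−θ_eq‖_{L²} ≤ e^{−μt}‖θ(0)−θ_eq‖_{L²} + |∂₃θ_eq| ∫₀^t e^{−μ(t−s)} g(s) ds`. -/
theorem rigid_robin_decay
    (d κ L₁ L₂ θbar βp βm : ℝ)
    (hd : 0 < d) (hκ : 0 < κ) (hL₁ : 0 < L₁) (hL₂ : 0 < L₂)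
    (hβp : 0 < βp) (hβm : 0 < βm)
    (u : ℝ → (Fin 3 → ℝ) → (Fin 3 → ℝ)) (θ : ℝ → (Fin 3 → ℝ) → ℝ)
    (hu_smooth : ContDiff ℝ (⊤ : ℕ∞) (fun q : ℝ × (Fin 3 → ℝ) => u q.1 q.2))
    (hθ_smooth : ContDiff ℝ (⊤ : ℕ∞) (fun q : ℝ × (Fin 3 → ℝ) => θ q.1 q.2))
    (hθ_bdd : ∃ M, ∀ t x, |θ t x| ≤ M)
    (hu_per1 : ∀ t x, u t (x + Pi.single 0 L₁) = u t x)
    (hu_per2 : ∀ t x, u t (x + Pi.single 1 L₂) = u t x)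
    (hθ_per1 : ∀ t x, θ t (x + Pi.single 0 L₁) = θ t x)
    (hθ_per2 : ∀ t x, θ t (x + Pi.single 1 L₂) = θ t x)
    (hdiv : ∀ t, 0 ≤ t → ∀ x ∈ slab L₁ L₂ d, (∑ i, pd i (fun y => u t y i) x) = 0)
    (hu3_top : ∀ t, 0 ≤ t → ∀ p : ℝ × ℝ, u t ![p.1, p.2, 0] 2 = 0)
    (hu3_bot : ∀ t, 0 ≤ t → ∀ p : ℝ × ℝ, u t ![p.1, p.2, -d] 2 = 0)
    (g : ℝ → ℝ) (hg_cont : Continuous g) (hg_nonneg : ∀ t, 0 ≤ g t)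
    (hu_L2 : ∀ t, 0 ≤ t →
      Real.sqrt (∫ x in slab L₁ L₂ d, ∑ i, (u t x i) ^ 2) ≤ g t)
    (hpde : ∀ t, 0 ≤ t → ∀ x ∈ slab L₁ L₂ d,
      deriv (fun s => θ s x) t + (∑ i, u t x i * pd i (θ t) x)
        = κ * ∑ i, pd i (pd i (θ t)) x)
    (hbc_top : ∀ t, 0 ≤ t → ∀ p : ℝ × ℝ,
      κ * pd 2 (θ t) ![p.1, p.2, 0] = βp * (θbar - θ t ![p.1, p.2, 0]))
    (hbc_bot : ∀ t, 0 ≤ t → ∀ p : ℝ × ℝ,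
      κ * pd 2 (θ t) ![p.1, p.2, -d] = βm * θ t ![p.1, p.2, -d])
    (θeq : (Fin 3 → ℝ) → ℝ)
    (hθeq : ∀ x, θeq x =
      (κ * βp * θbar + βp * βm * θbar * (x 2 + d)) / (κ * (βp + βm) + βp * βm * d))
    (dzθeq μ : ℝ)
    (hdz : dzθeq = βp * βm * θbar / (κ * (βp + βm) + βp * βm * d))
    (hμ : μ = min (κ * π ^ 2 / (4 * d ^ 2)) (βp * βm / κ)) :
    ∀ t, 0 ≤ t →
      Real.sqrt (∫ x in slab L₁ L₂ d, (θ t x - θeq x) ^ 2) ≤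
        Real.exp (-(μ * t)) * Real.sqrt (∫ x in slab L₁ L₂ d, (θ 0 x - θeq x) ^ 2)
          + |dzθeq| * ∫ s in (0 : ℝ)..t, Real.exp (-(μ * (t - s))) * g s := by
  have hD : 0 < κ * (βp + βm) + βp * βm * d := by positivity
  obtain ⟨k, hk, hkμ⟩ : ∃ k, 0 < k ∧ κ * k ^ 2 = μ := by
    have hμ_pos : 0 < μ := hμ ▸ lt_min (by positivity) (by positivity)
    exact ⟨√(μ / κ), sqrt_pos.2 (by positivity), by
      rw [sq_sqrt (by positivity)]; field_simp⟩
  have hkd : k * d ≤ π / 2 := by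
    have h1 : κ * k ^ 2 ≤ κ * π ^ 2 / (4 * d ^ 2) := hkμ ▸ hμ ▸ min_le_left _ _
    rw [le_div_iff₀ (by positivity)] at h1
    refine abs_le_of_sq_le_sq' ?_ (by positivity) |>.2
    refine le_of_mul_le_mul_left ?_ hκ
    linarith
  have hkh : k ^ 2 ≤ βp / κ * (βm / κ) := by
    have h1 : κ * k ^ 2 ≤ βp * βm / κ := hkμ ▸ hμ ▸ min_le_right _ _
    rw [div_mul_div_comm, le_div_iff₀ (by positivity)]
    rw [le_div_iff₀ hκ] at h1
    linarith
  obtain ⟨w, hw, hw_top, hw_bot⟩ :=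
    exists_robin_riccati_weight hd hk (div_pos hβp hκ) hkd hkh
  have hw_top' : -βp ≤ κ * w 0 := by
    have := mul_le_mul_of_nonneg_left hw_top hκ.le
    rwa [mul_neg, mul_div_cancel₀ _ hκ.ne'] at this
  have hw_bot' : κ * w (-d) ≤ βm := by
    have := mul_le_mul_of_nonneg_left hw_bot hκ.le
    rwa [mul_div_cancel₀ _ hκ.ne'] at this
  obtain ⟨q, hq⟩ : ∃ q : ℝ, q = κ * βp * θbar / (κ * (βp + βm) + βp * βm * d) + dzθeq * d :=
    ⟨_, rfl⟩
  have hθeq' : θeq = fun x => q + dzθeq * x 2 := by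
    funext x
    rw [hθeq, hq, hdz]
    ring
  have hθeq_smooth : ContDiff ℝ (⊤ : ℕ∞) θeq := by
    rw [hθeq']
    fun_prop
  have hθeq_deriv : ∀ i x, pd i θeq x = if i = 2 then dzθeq else 0 := fun i x => by
    have h1 : HasFDerivAt θeq (dzθeq • ContinuousLinearMap.proj 2 : (Fin 3 → ℝ) →L[ℝ] ℝ) x := by
      rw [hθeq']
      exact ((hasFDerivAt_apply 2 x).const_mul dzθeq).const_add q
    rw [pd, h1.fderiv]
    fin_cases i <;> simp
  let φ : ℝ → (Fin 3 → ℝ) → ℝ := fun t x => θ t x - θeq x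
  have hφ_smooth : ContDiff ℝ (⊤ : ℕ∞) fun q : ℝ × (Fin 3 → ℝ) => φ q.1 q.2 :=
    hθ_smooth.sub (hθeq_smooth.comp contDiff_snd)
  have hslice : ∀ t : ℝ, ContDiff ℝ (⊤ : ℕ∞) fun x : Fin 3 → ℝ => (t, x) :=
    fun t => contDiff_const.prodMk contDiff_id
  have hθt : ∀ t, ContDiff ℝ (⊤ : ℕ∞) (θ t) := fun t => hθ_smooth.comp (hslice t)
  have hφt : ∀ t, ContDiff ℝ (⊤ : ℕ∞) (φ t) := fun t => hφ_smooth.comp (hslice t)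
  have hut : ∀ t, ContDiff ℝ (⊤ : ℕ∞) (u t) := fun t => hu_smooth.comp (hslice t)
  have hφ_pd : ∀ t i, pd i (φ t) = fun x => pd i (θ t) x - if i = 2 then dzθeq else 0 := by
    intro t i
    funext x
    rw [← hθeq_deriv i x]
    exact congrArg (· (Pi.single i 1)) (fderiv_fun_sub ((hθt t).differentiable (by simp) x)
      (hθeq_smooth.differentiable (by simp) x))
  have hφ_pd2 : ∀ t i x, pd i (pd i (φ t)) x = pd i (pd i (θ t)) x := fun t i x => by
    rw [hφ_pd, pd, fderiv_sub_const, pd]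
  let φ' : ℝ → (Fin 3 → ℝ) → ℝ := fun t x =>
    fderiv ℝ (fun q : ℝ × (Fin 3 → ℝ) => θ q.1 q.2) (t, x) (1, 0)
  have hφ'_cont : Continuous fun q : ℝ × (Fin 3 → ℝ) => φ' q.1 q.2 :=
    (hθ_smooth.continuous_fderiv (by simp)).clm_apply continuous_const
  have hθ_deriv : ∀ t x, HasDerivAt (fun s => θ s x) (φ' t x) t := fun t x =>
    HasFDerivAt.comp_hasDerivAt (l := fun q : ℝ × (Fin 3 → ℝ) => θ q.1 q.2) t
      (hθ_smooth.differentiable (by simp) (t, x)).hasFDerivAt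
      ((hasDerivAt_id t).prodMk (hasDerivAt_const t x))
  have hE : ∀ t, HasDerivAt (fun t => ∫ x in slab L₁ L₂ d, φ t x ^ 2)
      (∫ x in slab L₁ L₂ d, 2 * (φ t x * φ' t x)) t := by
    have hc := hφ_smooth.continuous
    refine hasDerivAt_setIntegral_slab (F := fun t x => φ t x ^ 2)
      (F' := fun t x => 2 * (φ t x * φ' t x)) (hc.pow 2) (by fun_prop) fun t x => ?_
    refine (((hθ_deriv t x).sub_const (θeq x)).pow 2).congr_deriv ?_
    simp only [φ]
    push_cast
    ring
  intro t ht
  refine sqrt_le_exp_mul_sqrt_add_integral (hkμ ▸ by positivity) (abs_nonneg dzθeq) hE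
    (fun s => integral_nonneg fun x => sq_nonneg _) hg_cont hg_nonneg (fun s hs => ?_) ht
  have hfc := (hφt s).continuous
  have huc : ∀ i, Continuous fun x => u s x i := fun i =>
    (continuous_apply i).comp (hut s).continuous
  have hpc : ∀ i, Continuous (pd i (φ s)) := fun i =>
    ((hφt s).pd (m := 0) (by simp) i).continuous
  have hppc : ∀ i, Continuous (pd i (pd i (φ s))) := fun i =>
    (((hφt s).pd (m := 1) (by norm_cast) i).pd (m := 0) (by simp) i).continuous
  have henergy := robin_energy_inequality (f := φ s) (v := u s) hd hκ hL₁ hL₂ hw hw_top' hw_bot'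
    ((hφt s).of_le (by norm_cast)) ((hut s).of_le (by norm_cast)) (hu_per1 s) (hu_per2 s)
    (fun x => by simp [φ, hθ_per1, hθeq']) (fun x => by simp [φ, hθ_per2, hθeq'])
    (hdiv s hs) (hu3_top s hs) (hu3_bot s hs)
    (fun p => by
      have h1 := hbc_top s hs p
      rw [hφ_pd]
      simp only [φ, mul_sub, h1, hθeq, hdz, if_true, Matrix.cons_val]
      field_simp
      ring)
    (fun p => by
      have h1 := hbc_bot s hs p
      rw [hφ_pd]
      simp only [φ, mul_sub, h1, hθeq, hdz, if_true, Matrix.cons_val]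
      field_simp
      ring)
  have hsplit : ∫ x in slab L₁ L₂ d, 2 * (φ s x * φ' s x) =
      2 * (∫ x in slab L₁ L₂ d,
        φ s x * (κ * ∑ i, pd i (pd i (φ s)) x - ∑ i, u s x i * pd i (φ s) x))
      - 2 * dzθeq * ∫ x in slab L₁ L₂ d, φ s x * u s x 2 := by
    rw [← integral_const_mul, ← integral_const_mul, ← integral_sub
      (Continuous.integrableOn_slab (by fun_prop)) (Continuous.integrableOn_slab (by fun_prop))]
    refine setIntegral_congr_fun (measurableSet_slab _ _ _) fun x hx => ?_
    have h1 := hpde s hs x hx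
    rw [(hθ_deriv s x).deriv] at h1
    simp only [hφ_pd2]
    simp only [hφ_pd, mul_sub, Finset.sum_sub_distrib, mul_ite, mul_zero, Finset.sum_ite_eq',
      Finset.mem_univ, if_true]
    linear_combination 2 * φ s x * h1
  have hu2 : √(∫ x in slab L₁ L₂ d, u s x 2 ^ 2) ≤ g s := by
    refine (sqrt_le_sqrt ?_).trans (hu_L2 s hs)
    refine setIntegral_mono (Continuous.integrableOn_slab (by fun_prop))
      (Continuous.integrableOn_slab (by fun_prop)) fun x => ?_
    exact Finset.single_le_sum (f := fun i => u s x i ^ 2) (fun i _ => sq_nonneg _)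
      (Finset.mem_univ 2)
  have hcs : |∫ x in slab L₁ L₂ d, φ s x * u s x 2| ≤
      √(∫ x in slab L₁ L₂ d, φ s x ^ 2) * g s :=
    (abs_setIntegral_slab_mul_le hfc (huc 2)).trans (by gcongr)
  have hflux : -(dzθeq * ∫ x in slab L₁ L₂ d, φ s x * u s x 2) ≤
      |dzθeq| * (√(∫ x in slab L₁ L₂ d, φ s x ^ 2) * g s) := by
    refine (neg_le_abs _).trans ?_
    rw [abs_mul]
    gcongr
  rw [hkμ] at henergy
  rw [hsplit]
  linarith
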